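/- arXiv:2409.08727 — 2 statements merged into one kernel-verified Lean document; each statement's English description precedes it below -/
import Mathlib

section
/- Let B be a strong bimonoid. The following two statements are equivalent: (1) B is right-distributive; (2) for every alphabet Γ and every weighted automaton A over Γ and B, ⟦A⟧^run = ⟦A⟧^init. -/
/-! Strong bimonoids -/

structure StrongBimonoid (B : Type) where
  add : B → B → B
  mul : B → B → B
  zero : B
  one : B
  add_assoc : ∀ a b c, add (add a b) c = add a (add b c)
  add_comm : ∀ a b, add a b = add b a
  add_zero : ∀ a, add a zero = a
  mul_assoc : ∀ a b c, mul (mul a b) c = mul a (mul b c)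
  one_mul : ∀ a, mul one a = a
  mul_one : ∀ a, mul a one = a
  zero_mul : ∀ a, mul zero a = zero
  mul_zero : ∀ a, mul a zero = zero

namespace StrongBimonoid

variable {B : Type} (S : StrongBimonoid B)

/-- The additive commutative monoid underlying a strong bimonoid. -/
def acm : AddCommMonoid B where
  add := S.add
  zero := S.zero
  add_assoc := S.add_assoc
  zero_add := fun a => (S.add_comm S.zero a).trans (S.add_zero a)
  add_zero := S.add_zero
  add_comm := S.add_comm
  nsmul := fun n a => Nat.rec S.zero (fun _ ih => S.add ih a) n
  nsmul_zero := fun _ => rfl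
  nsmul_succ := fun _ _ => rfl

/-- Finite sum (w.r.t. `S.add`, `S.zero`) of `f` over a finite index set. -/
def fsum {ι : Type} (t : Finset ι) (f : ι → B) : B :=
  @Finset.sum ι B S.acm t f

/-- Ordered product `f 0 ⊗ f 1 ⊗ ⋯ ⊗ f (k-1)` (empty product is `S.one`). -/
def finProd : {k : ℕ} → (Fin k → B) → B
  | 0, _ => S.one
  | _ + 1, f => S.mul (f 0) (finProd (fun i => f i.succ))

def ZeroSumFree : Prop :=
  ∀ a b, S.add a b = S.zero → a = S.zero ∧ b = S.zero

def StronglyZeroSumFree : Prop :=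
  ∀ a b c, S.mul (S.add a b) c = S.zero ↔ (S.mul a c = S.zero ∧ S.mul b c = S.zero)

def BiStronglyZeroSumFree : Prop :=
  ∀ a b b' c, S.mul (S.mul a (S.add b b')) c = S.zero ↔
    (S.mul (S.mul a b) c = S.zero ∧ S.mul (S.mul a b') c = S.zero)

def ZeroDivisorFree : Prop :=
  ∀ a b, S.mul a b = S.zero ↔ (a = S.zero ∨ b = S.zero)

def Positive : Prop := S.ZeroSumFree ∧ S.ZeroDivisorFree

def RightDistributive : Prop :=
  ∀ a b c, S.mul (S.add a b) c = S.add (S.mul a c) (S.mul b c)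

def LeftDistributive : Prop :=
  ∀ a b c, S.mul a (S.add b c) = S.add (S.mul a b) (S.mul a c)

def ZeroRightDistributive : Prop :=
  ∀ a b c, (S.mul (S.add a b) c = S.zero ↔ S.add (S.mul a c) (S.mul b c) = S.zero)

def CommutativeMul : Prop := ∀ a b, S.mul a b = S.mul b a

end StrongBimonoid

/-! Weighted automata over words -/

section Word

variable {B : Type} {Γ : Type} {Q : Type}

/-- The product `μ(a₁)_{ρ₀,ρ₁} ⊗ ⋯ ⊗ μ(aₙ)_{ρₙ₋₁,ρₙ}` of the transition weights
along the run `ρ` on the word `w = a₁⋯aₙ`. -/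
def transProd (S : StrongBimonoid B) (μ : Γ → Q → Q → B) :
    (w : List Γ) → (Fin (w.length + 1) → Q) → B
  | [], _ => S.one
  | a :: w, ρ => S.mul (μ a (ρ 0) (ρ 1)) (transProd S μ w (fun i => ρ i.succ))

/-- Run semantics of the weighted automaton `(Q, I, μ, F)` over `Γ` and `S`. -/
def runSem (S : StrongBimonoid B) [Fintype Q] (I : Q → B) (μ : Γ → Q → Q → B)
    (F : Q → B) (w : List Γ) : B :=
  S.fsum Finset.univ (fun ρ : Fin (w.length + 1) → Q =>
    S.mul (S.mul (I (ρ 0)) (transProd S μ w ρ)) (F (ρ (Fin.last w.length))))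

/-- `hWord S μ w v` is the vector `v ⊗ μ(a₁) ⊗ ⋯ ⊗ μ(aₙ)` (left-associated
vector-matrix products) for `w = a₁⋯aₙ`. -/
def hWord (S : StrongBimonoid B) [Fintype Q] (μ : Γ → Q → Q → B) :
    List Γ → (Q → B) → (Q → B)
  | [], v => v
  | a :: w, v =>
      hWord S μ w (fun q => S.fsum Finset.univ (fun p => S.mul (v p) (μ a p q)))

/-- Initial algebra semantics of the weighted automaton `(Q, I, μ, F)`. -/
def initSem (S : StrongBimonoid B) [Fintype Q] (I : Q → B) (μ : Γ → Q → Q → B)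
    (F : Q → B) (w : List Γ) : B :=
  S.fsum Finset.univ (fun q => S.mul (hWord S μ w I q) (F q))

end Word

/-! Ranked alphabets, trees and weighted tree automata -/

/-- Trees over the ranked alphabet `(σ, rk)`: a node labelled `s` has exactly
`rk s` children. -/
inductive RTree (σ : Type) (rk : σ → ℕ) : Type where
  | node (s : σ) (ts : Fin (rk s) → RTree σ rk) : RTree σ rk

/-- The ranked alphabet is trivial if all symbols have rank 0. -/
def RankTrivial {σ : Type} (rk : σ → ℕ) : Prop := ∀ s, rk s = 0

/-- The ranked alphabet is branching if some symbol has rank ≥ 2. -/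
def RankBranching {σ : Type} (rk : σ → ℕ) : Prop := ∃ s, 2 ≤ rk s

/-- A run of an automaton with state set `Q` on a tree: an assignment of a
state to every position of the tree. -/
inductive TreeRun (σ : Type) (rk : σ → ℕ) (Q : Type) : RTree σ rk → Type where
  | node {s : σ} {ts : Fin (rk s) → RTree σ rk} (q : Q)
      (rs : (i : Fin (rk s)) → TreeRun σ rk Q (ts i)) :
      TreeRun σ rk Q (RTree.node s ts)

/-- The state assigned by a run to the root. -/
def TreeRun.root {σ : Type} {rk : σ → ℕ} {Q : Type} {t : RTree σ rk} :
    TreeRun σ rk Q t → Q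
  | .node q _ => q

def treeRunFintype {σ : Type} {rk : σ → ℕ} (Q : Type) [Fintype Q] :
    (t : RTree σ rk) → Fintype (TreeRun σ rk Q t)
  | RTree.node s ts =>
    letI : ∀ i, Fintype (TreeRun σ rk Q (ts i)) := fun i => treeRunFintype Q (ts i)
    Fintype.ofEquiv (Q × ((i : Fin (rk s)) → TreeRun σ rk Q (ts i)))
      { toFun := fun p => TreeRun.node p.1 p.2
        invFun := fun r => match r with | TreeRun.node q rs => (q, rs)
        left_inv := fun _ => rfl
        right_inv := fun r => match r with | TreeRun.node _ _ => rfl }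

instance {σ : Type} {rk : σ → ℕ} {Q : Type} [Fintype Q] (t : RTree σ rk) :
    Fintype (TreeRun σ rk Q t) := treeRunFintype Q t

/-- The weight of a run on a tree. -/
def treeWt {B : Type} {σ : Type} {rk : σ → ℕ} {Q : Type} (S : StrongBimonoid B)
    (δ : (s : σ) → (Fin (rk s) → Q) → Q → B) :
    (t : RTree σ rk) → TreeRun σ rk Q t → B
  | _, TreeRun.node (s := s) (ts := ts) q rs =>
      S.mul (S.finProd (fun i => treeWt S δ (ts i) (rs i)))
        (δ s (fun i => (rs i).root) q)

/-- Run semantics of the weighted tree automaton `(Q, δ, F)`. -/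
def treeRunSem {B : Type} {σ : Type} {rk : σ → ℕ} {Q : Type} (S : StrongBimonoid B)
    [Fintype Q] (δ : (s : σ) → (Fin (rk s) → Q) → Q → B) (F : Q → B)
    (t : RTree σ rk) : B :=
  S.fsum Finset.univ (fun ρ : TreeRun σ rk Q t => S.mul (treeWt S δ t ρ) (F ρ.root))

/-- The map `h_A : T_Σ → B^Q` of the initial algebra semantics. -/
def treeH {B : Type} {σ : Type} {rk : σ → ℕ} {Q : Type} (S : StrongBimonoid B)
    [Fintype Q] (δ : (s : σ) → (Fin (rk s) → Q) → Q → B) :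
    RTree σ rk → Q → B
  | RTree.node s ts => fun q =>
      S.fsum Finset.univ (fun qs : Fin (rk s) → Q =>
        S.mul (S.finProd (fun i => treeH S δ (ts i) (qs i))) (δ s qs q))

/-- Initial algebra semantics of the weighted tree automaton `(Q, δ, F)`. -/
def treeInitSem {B : Type} {σ : Type} {rk : σ → ℕ} {Q : Type} (S : StrongBimonoid B)
    [Fintype Q] (δ : (s : σ) → (Fin (rk s) → Q) → Q → B) (F : Q → B)
    (t : RTree σ rk) : B :=
  S.fsum Finset.univ (fun q => S.mul (treeH S δ t q) (F q))


namespace StrongBimonoid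

variable {B : Type} (S : StrongBimonoid B)

theorem fsum_congr {ι : Type} {t : Finset ι} {f g : ι → B} (h : ∀ i ∈ t, f i = g i) :
    S.fsum t f = S.fsum t g :=
  letI := S.acm
  Finset.sum_congr rfl h

theorem fsum_comm {ι κ : Type} (s : Finset ι) (t : Finset κ) (f : ι → κ → B) :
    S.fsum s (fun i => S.fsum t (f i)) = S.fsum t (fun j => S.fsum s (fun i => f i j)) :=
  letI := S.acm
  Finset.sum_comm

theorem fsum_univ_equiv {ι κ : Type} [Fintype ι] [Fintype κ] (e : ι ≃ κ) (f : κ → B) :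
    S.fsum Finset.univ (fun i => f (e i)) = S.fsum Finset.univ f :=
  letI := S.acm
  Equiv.sum_comp e f

theorem fsum_univ_prod {ι κ : Type} [Fintype ι] [Fintype κ] (f : ι × κ → B) :
    S.fsum Finset.univ f =
      S.fsum Finset.univ (fun i => S.fsum Finset.univ (fun j => f (i, j))) :=
  letI := S.acm
  Fintype.sum_prod_type f

theorem fsum_univ_bool (f : Bool → B) :
    S.fsum Finset.univ f = S.add (f true) (f false) :=
  letI := S.acm
  Fintype.sum_bool f

theorem fsum_mul (hS : S.RightDistributive) {ι : Type} (t : Finset ι) (f : ι → B) (c : B) :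
    S.mul (S.fsum t f) c = S.fsum t (fun i => S.mul (f i) c) :=
  letI := S.acm
  map_sum (G := B →+ B)
    { toFun := fun b => S.mul b c
      map_zero' := S.zero_mul c
      map_add' := fun a b => hS a b c } f t

end StrongBimonoid

section RunInit

variable {B Γ Q : Type} (S : StrongBimonoid B) [Fintype Q] (I : Q → B) (μ : Γ → Q → Q → B)
  (F : Q → B)

theorem runSem_nil :
    runSem S I μ F [] = S.fsum Finset.univ (fun q => S.mul (I q) (F q)) := by
  rw [← S.fsum_univ_equiv (Equiv.funUnique (Fin 1) Q)]
  refine S.fsum_congr fun ρ _ => ?_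
  change S.mul (S.mul (I (ρ 0)) S.one) (F (ρ 0)) = S.mul (I (ρ 0)) (F (ρ 0))
  rw [S.mul_one]

/-- A run on `a :: w` is an initial state together with a run on `w`. -/
theorem runSem_cons (a : Γ) (w : List Γ) :
    runSem S I μ F (a :: w) =
      S.fsum Finset.univ (fun ρ : Fin (w.length + 1) → Q => S.fsum Finset.univ (fun p =>
        S.mul (S.mul (S.mul (I p) (μ a p (ρ 0))) (transProd S μ w ρ))
          (F (ρ (Fin.last w.length))))) := by
  rw [S.fsum_comm, ← S.fsum_univ_prod (fun x : Q × (Fin (w.length + 1) → Q) =>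
    S.mul (S.mul (S.mul (I x.1) (μ a x.1 (x.2 0))) (transProd S μ w x.2))
      (F (x.2 (Fin.last w.length))))]
  refine (S.fsum_univ_equiv (Fin.consEquiv fun _ : Fin (w.length + 2) => Q) _).symm.trans ?_
  refine S.fsum_congr fun x _ => ?_
  rw [S.mul_assoc (I x.1)]
  rfl

theorem runSem_singleton (a : Γ) :
    runSem S I μ F [a] = S.fsum Finset.univ (fun q => S.fsum Finset.univ (fun p =>
      S.mul (S.mul (I p) (μ a p q)) (F q))) := by
  rw [runSem_cons, ← S.fsum_univ_equiv (Equiv.funUnique (Fin 1) Q)]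
  refine S.fsum_congr fun ρ _ => S.fsum_congr fun p _ => ?_
  change S.mul (S.mul _ S.one) (F (ρ 0)) = S.mul _ (F (ρ 0))
  rw [S.mul_one]
  rfl

theorem runSem_eq_initSem (hS : S.RightDistributive) (w : List Γ) :
    runSem S I μ F w = initSem S I μ F w := by
  induction w generalizing I with
  | nil => exact runSem_nil S I μ F
  | cons a w ih =>
    refine Eq.trans ?_ (ih fun q => S.fsum Finset.univ (fun p => S.mul (I p) (μ a p q)))
    rw [runSem_cons]
    refine S.fsum_congr fun ρ _ => ?_
    rw [S.fsum_mul hS, S.fsum_mul hS]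

end RunInit

theorem stmt4 {B : Type} (S : StrongBimonoid B) :
    S.RightDistributive ↔
      (∀ (Γ : Type) [Fintype Γ] [Nonempty Γ],
        ∀ (Q : Type) [Fintype Q] [Nonempty Q] (I : Q → B) (μ : Γ → Q → Q → B) (F : Q → B),
          runSem S I μ F = initSem S I μ F) := by
  refine ⟨fun hS Γ _ _ Q _ _ I μ F => funext (runSem_eq_initSem S I μ F hS), fun h a b c => ?_⟩
  have key := congrFun (h Unit Bool (fun p => cond p a b)
    (fun _ _ q => cond q S.one S.zero) (fun q => cond q c S.zero)) [()]
  rw [runSem_singleton] at key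
  simpa [-Fintype.univ_bool, initSem, hWord, S.fsum_univ_bool, S.mul_one, S.mul_zero, S.add_zero] using key.symm
end

section
/- Let Σ be a ranked alphabet and B be a zero-sum-free strong bimonoid. Then the following two statements are equivalent: (1) if Σ is not trivial, then for all b,b',c ∈ B, b ⊗ c ≠ 𝟘 implies (b ⊕ b') ⊗ c ≠ 𝟘, and if Σ is branching, then for all a,b,b',c ∈ B, a ⊗ b ⊗ c ≠ 𝟘 implies a ⊗ (b ⊕ b') ⊗ c ≠ 𝟘; (2) for each weighted tree automaton A over Σ and B, supp(⟦A⟧^run) ⊆ supp(⟦A⟧^init). -/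
namespace StrongBimonoid

variable {B : Type} (S : StrongBimonoid B)

theorem exists_fsum_univ_eq_add {ι : Type} [Fintype ι] (f : ι → B) (i : ι) :
    ∃ r, S.fsum Finset.univ f = S.add (f i) r := by
  classical
  let := S.acm
  exact ⟨_, (Finset.add_sum_erase Finset.univ f (Finset.mem_univ i)).symm⟩

theorem ZeroSumFree.fsum_univ_ne_zero {S : StrongBimonoid B} (h : S.ZeroSumFree)
    {ι : Type} [Fintype ι] {f : ι → B} (i : ι) (hi : f i ≠ S.zero) :
    S.fsum Finset.univ f ≠ S.zero := by
  obtain ⟨r, hr⟩ := S.exists_fsum_univ_eq_add f i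
  rw [hr]
  exact fun h0 => hi (h _ _ h0).1

theorem exists_ne_zero_of_fsum_ne_zero {ι : Type} {t : Finset ι} {f : ι → B}
    (h : S.fsum t f ≠ S.zero) : ∃ i, f i ≠ S.zero := by
  by_contra! hf
  let := S.acm
  exact h (Finset.sum_eq_zero fun i _ => hf i)

theorem fsum_univ_eq_single {ι : Type} [Fintype ι] {f : ι → B} (i : ι)
    (h : ∀ j, j ≠ i → f j = S.zero) : S.fsum Finset.univ f = f i := by
  let := S.acm
  exact Fintype.sum_eq_single i h

theorem fsum_univ_eq_add {ι : Type} [Fintype ι] {f : ι → B} (i j : ι) (hij : i ≠ j)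
    (h : ∀ k, k ≠ i → k ≠ j → f k = S.zero) :
    S.fsum Finset.univ f = S.add (f i) (f j) := by
  classical
  let := S.acm
  exact Fintype.sum_eq_add i j hij fun k hk => h k hk.1 hk.2

theorem finProd_eq_one {k : ℕ} {f : Fin k → B} (h : ∀ i, f i = S.one) :
    S.finProd f = S.one := by
  induction k with
  | zero => rfl
  | succ k ih => rw [finProd, h 0, S.one_mul, ih fun i => h i.succ]

theorem finProd_eq_mul {k : ℕ} (hk : 2 ≤ k) {f : Fin k → B} {a b : B}
    (h0 : ∀ i : Fin k, i.val = 0 → f i = a) (h1 : ∀ i : Fin k, i.val = 1 → f i = b)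
    (h2 : ∀ i : Fin k, 2 ≤ i.val → f i = S.one) : S.finProd f = S.mul a b := by
  obtain ⟨n, rfl⟩ := Nat.exists_eq_add_of_le' hk
  rw [finProd, finProd, S.finProd_eq_one fun i => h2 i.succ.succ (by simp), S.mul_one,
    h0 0 rfl, h1 _ rfl]

/-- The factors of a product can be replaced from left to right, provided that each replacement
preserves being nonzero in every context. -/
theorem mul_finProd_ne_zero_of_forall {k : ℕ} {f g : Fin k → B}
    (h : ∀ i a c, S.mul (S.mul a (f i)) c ≠ S.zero → S.mul (S.mul a (g i)) c ≠ S.zero) :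
    ∀ a c, S.mul (S.mul a (S.finProd f)) c ≠ S.zero →
      S.mul (S.mul a (S.finProd g)) c ≠ S.zero := by
  induction k with
  | zero => exact fun a c => id
  | succ k ih =>
    intro a c hne
    rw [finProd, ← S.mul_assoc] at hne ⊢
    apply ih fun i => h i.succ
    rw [S.mul_assoc] at hne ⊢
    exact h 0 a _ hne

end StrongBimonoid

section TreeAutomata

variable {B σ Q : Type} {rk : σ → ℕ} {S : StrongBimonoid B}
  {δ : (s : σ) → (Fin (rk s) → Q) → Q → B}

theorem TreeRun.root_node {s : σ} {ts : Fin (rk s) → RTree σ rk} (q : Q)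
    (rs : ∀ i, TreeRun σ rk Q (ts i)) : (TreeRun.node q rs).root = q := rfl

theorem treeWt_node {s : σ} {ts : Fin (rk s) → RTree σ rk} (q : Q)
    (rs : ∀ i, TreeRun σ rk Q (ts i)) :
    treeWt S δ (.node s ts) (.node q rs) =
      S.mul (S.finProd fun i => treeWt S δ (ts i) (rs i)) (δ s (fun i => (rs i).root) q) := rfl

theorem treeH_node [Fintype Q] (s : σ) (ts : Fin (rk s) → RTree σ rk) (q : Q) :
    treeH S δ (.node s ts) q = S.fsum Finset.univ fun qs : Fin (rk s) → Q =>
      S.mul (S.finProd fun i => treeH S δ (ts i) (qs i)) (δ s qs q) := rfl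

theorem mul_treeH_ne_zero_of_branching [Fintype Q]
    (h : ∀ a b b' c : B, S.mul (S.mul a b) c ≠ S.zero → S.mul (S.mul a (S.add b b')) c ≠ S.zero)
    {t : RTree σ rk} (ρ : TreeRun σ rk Q t) :
    ∀ a c, S.mul (S.mul a (treeWt S δ t ρ)) c ≠ S.zero →
      S.mul (S.mul a (treeH S δ t ρ.root)) c ≠ S.zero := by
  induction ρ with
  | @node s ts q rs ih =>
    intro a c hne
    rw [treeWt_node, ← S.mul_assoc, S.mul_assoc] at hne
    have hH := S.mul_finProd_ne_zero_of_forall ih _ _ hne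
    rw [← S.mul_assoc, S.mul_assoc a] at hH
    obtain ⟨r, hr⟩ := S.exists_fsum_univ_eq_add
      (fun qs : Fin (rk s) → Q =>
        S.mul (S.finProd fun i => treeH S δ (ts i) (qs i)) (δ s qs q)) fun i => (rs i).root
    rw [TreeRun.root_node, treeH_node, hr]
    exact h _ _ _ _ hH

theorem treeH_mul_ne_zero_of_not_branching [Fintype Q] (hb : ¬ RankBranching rk)
    (h : ¬ RankTrivial rk →
      ∀ b b' c : B, S.mul b c ≠ S.zero → S.mul (S.add b b') c ≠ S.zero)
    {t : RTree σ rk} (ρ : TreeRun σ rk Q t) :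
    ∀ c, S.mul (treeWt S δ t ρ) c ≠ S.zero → S.mul (treeH S δ t ρ.root) c ≠ S.zero := by
  induction ρ with
  | @node s ts q rs ih =>
    intro c hne
    rw [treeWt_node, S.mul_assoc] at hne
    have hprod : ∀ {k : ℕ} {f g : Fin k → B}, k < 2 →
        (∀ i c, S.mul (f i) c ≠ S.zero → S.mul (g i) c ≠ S.zero) →
        ∀ c, S.mul (S.finProd f) c ≠ S.zero → S.mul (S.finProd g) c ≠ S.zero := by
      intro k f g hk hfg c
      match k, hk with
      | 0, _ => exact id
      | 1, _ => simpa only [StrongBimonoid.finProd, S.mul_one] using hfg 0 c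
    have hlt : rk s < 2 := not_le.1 fun h2 => hb ⟨s, h2⟩
    have hH := hprod hlt ih _ hne
    rw [← S.mul_assoc] at hH
    rw [TreeRun.root_node, treeH_node]
    by_cases hs : rk s = 0
    · have : IsEmpty (Fin (rk s)) := by rw [hs]; infer_instance
      rw [S.fsum_univ_eq_single (fun i => (rs i).root)
        fun j hj => (hj (Subsingleton.elim _ _)).elim]
      exact hH
    · obtain ⟨r, hr⟩ := S.exists_fsum_univ_eq_add
        (fun qs : Fin (rk s) → Q =>
          S.mul (S.finProd fun i => treeH S δ (ts i) (qs i)) (δ s qs q)) fun i => (rs i).root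
      rw [hr]
      exact h (fun ht => hs (ht s)) _ _ _ hH

/-- Transition weights which depend on the symbol only through it being nullary or not. -/
def rankTransition (rk : σ → ℕ) (leaf : Q → B) (inner : {k : ℕ} → (Fin k → Q) → Q → B)
    (s : σ) (qs : Fin (rk s) → Q) (q : Q) : B :=
  if rk s = 0 then leaf q else inner qs q

/-- The tree consisting of a single node labelled by a nullary symbol. -/
def RTree.leaf (s : σ) (hs : rk s = 0) : RTree σ rk :=
  .node s fun i => (Fin.cast hs i).elim0

/-- The run on a one-node tree assigning the given state. -/
def TreeRun.leaf (s : σ) (hs : rk s = 0) (q : Q) : TreeRun σ rk Q (RTree.leaf s hs) :=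
  .node q fun i => (Fin.cast hs i).elim0

theorem TreeRun.root_leaf {s : σ} (hs : rk s = 0) (q : Q) :
    (TreeRun.leaf s hs q).root = q := rfl

variable {leaf : Q → B} {inner : {k : ℕ} → (Fin k → Q) → Q → B}

theorem treeWt_leaf {s : σ} (hs : rk s = 0) (q : Q) :
    treeWt S (rankTransition rk leaf inner) (RTree.leaf s hs) (TreeRun.leaf s hs q) = leaf q := by
  refine (treeWt_node _ _).trans ?_
  rw [rankTransition, if_pos hs,
    S.finProd_eq_one fun i => (Fin.cast hs i).elim0, S.one_mul]

theorem treeH_leaf [Fintype Q] {s : σ} (hs : rk s = 0) (q : Q) :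
    treeH S (rankTransition rk leaf inner) (RTree.leaf s hs) q = leaf q := by
  have : IsEmpty (Fin (rk s)) := by rw [hs]; infer_instance
  rw [RTree.leaf, treeH_node, S.fsum_univ_eq_single isEmptyElim
      fun j hj => (hj (Subsingleton.elim _ _)).elim,
    S.finProd_eq_one isEmptyElim, S.one_mul, rankTransition, if_pos hs]

end TreeAutomata

section SeparatingAutomata

variable {B σ : Type} {rk : σ → ℕ} (S : StrongBimonoid B)

open Classical in
/-- Weights of transitions at inner nodes: `b` and `b'` lead to `true` from the two constant
tuples of states, everything else has weight zero. -/
noncomputable def choiceInner (b b' : B) {k : ℕ} (qs : Fin k → Bool) (q : Bool) : B :=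
  if q = false then S.zero
  else if qs = fun _ => true then b
  else if qs = fun _ => false then b'
  else S.zero

theorem add_mul_ne_zero_of_supp_subset (h0 : ∃ s, rk s = 0) (hzsf : S.ZeroSumFree)
    (h : ∀ (Q : Type) [Fintype Q] [Nonempty Q] (δ : (s : σ) → (Fin (rk s) → Q) → Q → B)
      (F : Q → B), {t : RTree σ rk | treeRunSem S δ F t ≠ S.zero} ⊆
        {t : RTree σ rk | treeInitSem S δ F t ≠ S.zero})
    (hrk : ¬ RankTrivial rk) (b b' c : B) (hbc : S.mul b c ≠ S.zero) :
    S.mul (S.add b b') c ≠ S.zero := by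
  obtain ⟨α, hα⟩ := h0
  obtain ⟨s, hs⟩ := not_forall.1 hrk
  let δ := rankTransition rk (fun _ : Bool => S.one) (choiceInner S b b')
  let F : Bool → B := fun q => if q then c else S.zero
  let t : RTree σ rk := .node s fun _ => .leaf α hα
  have hne : (fun _ : Fin (rk s) => true) ≠ fun _ => false := fun he =>
    Bool.noConfusion (congrFun he ⟨0, Nat.pos_of_ne_zero hs⟩)
  have hrun : treeRunSem S δ F t ≠ S.zero := by
    refine hzsf.fsum_univ_ne_zero (.node true fun _ => .leaf α hα true) ?_
    rw [treeWt_node, S.finProd_eq_one fun i => treeWt_leaf hα true, S.one_mul]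
    simpa [δ, rankTransition, hs, choiceInner, F, TreeRun.root_leaf, TreeRun.root_node, t]
      using hbc
  have hinit : treeInitSem S δ F t = S.mul (S.add b b') c := by
    rw [treeInitSem, S.fsum_univ_eq_single true]
    · have hH : treeH S δ t true = S.add b b' := by
        rw [treeH_node, S.fsum_univ_eq_add (fun _ => true) (fun _ => false) hne,
          S.finProd_eq_one fun i => treeH_leaf hα true,
          S.finProd_eq_one fun i => treeH_leaf hα false]
        · simp [δ, S.one_mul, rankTransition, hs, choiceInner, hne.symm]
        · intro qs h1 h2
          simp [δ, rankTransition, hs, choiceInner, h1, h2, S.mul_zero]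
      rw [hH]
      rfl
    · intro q hq
      simp [F, hq, S.mul_zero]
  exact hinit ▸ h Bool δ F hrun

/-- The states of the automaton separating the two semantics over a branching alphabet. -/
inductive BranchState
  | left | fst | snd | mid | top

namespace BranchState

open Classical in
noncomputable instance : Fintype BranchState where
  elems := {left, fst, snd, mid, top}
  complete q := by cases q <;> simp

/-- The tuple of states `(left, mid, fst, …, fst)`. -/
def children {k : ℕ} (i : Fin k) : BranchState :=
  if i.val = 0 then left else if i.val = 1 then mid else fst

/-- Weights of transitions at nullary symbols. -/
def leafWeight (a : B) : BranchState → B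
  | left => a
  | fst => S.one
  | snd => S.one
  | mid => S.zero
  | top => S.zero

open Classical in
/-- Weights of transitions at inner nodes: `mid` is reached with weight `b` from `(fst, …, fst)`
and `b'` from `(snd, …, snd)`, and `top` is reached with weight `c` from
`(left, mid, fst, …, fst)`. -/
noncomputable def innerWeight (b b' c : B) {k : ℕ} (qs : Fin k → BranchState) : BranchState → B
  | mid => if qs = fun _ => fst then b else if qs = fun _ => snd then b' else S.zero
  | top => if qs = children then c else S.zero
  | _ => S.zero

/-- Final weights: only `top` is final. -/
def finalWeight : BranchState → B
  | top => S.one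
  | _ => S.zero

end BranchState

open BranchState in
theorem mul_add_mul_ne_zero_of_supp_subset (h0 : ∃ s, rk s = 0) (hzsf : S.ZeroSumFree)
    (h : ∀ (Q : Type) [Fintype Q] [Nonempty Q] (δ : (s : σ) → (Fin (rk s) → Q) → Q → B)
      (F : Q → B), {t : RTree σ rk | treeRunSem S δ F t ≠ S.zero} ⊆
        {t : RTree σ rk | treeInitSem S δ F t ≠ S.zero})
    (hrk : RankBranching rk) (a b b' c : B) (habc : S.mul (S.mul a b) c ≠ S.zero) :
    S.mul (S.mul a (S.add b b')) c ≠ S.zero := by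
  obtain ⟨α, hα⟩ := h0
  obtain ⟨s, hs⟩ := hrk
  have hs0 : rk s ≠ 0 := by omega
  let δ := rankTransition rk (leafWeight S a) (innerWeight S b b' c)
  let u : RTree σ rk := .node s fun _ => .leaf α hα
  let t : RTree σ rk := .node s fun i => if i.val = 1 then u else .leaf α hα
  have hne : (fun _ : Fin (rk s) => fst) ≠ fun _ => snd := fun he =>
    BranchState.noConfusion (congrFun he ⟨0, Nat.pos_of_ne_zero hs0⟩)
  have hrun : treeRunSem S δ (finalWeight S) t ≠ S.zero := by
    let ρu : TreeRun σ rk BranchState u := .node mid fun _ => .leaf α hα fst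
    have hρu : treeWt S δ u ρu = b := by
      rw [treeWt_node, S.finProd_eq_one fun i => treeWt_leaf hα fst, S.one_mul]
      simp [δ, rankTransition, hs0, innerWeight, TreeRun.root_leaf]
    have hex : ∀ (i : Fin (rk s)) (x : RTree σ rk), x = (if i.val = 1 then u else .leaf α hα) →
        ∃ ρ : TreeRun σ rk BranchState x, ρ.root = children i ∧
          treeWt S δ x ρ = if i.val = 1 then b else leafWeight S a (children i) := by
      intro i x hx
      by_cases hi : i.val = 1
      · rw [if_pos hi] at hx
        subst hx
        exact ⟨ρu, by simp [ρu, u, TreeRun.root_node, children, hi], by rw [hρu, if_pos hi]⟩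
      · rw [if_neg hi] at hx
        subst hx
        exact ⟨.leaf α hα (children i), rfl, by rw [if_neg hi]; exact treeWt_leaf hα _⟩
    choose rs hroot hwt using fun i => hex i _ rfl
    refine hzsf.fsum_univ_ne_zero (.node top rs) ?_
    rw [treeWt_node, S.finProd_eq_mul hs (a := a) (b := b)]
    · simp only [hroot]
      simpa [δ, rankTransition, hs0, innerWeight, finalWeight, t, TreeRun.root_node, S.mul_one,
        show (fun i : Fin (rk s) => children i) = children from rfl] using habc
    · intro i hi
      simp [hwt, hi, children, leafWeight]
    · intro i hi
      simp [hwt, hi]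
    · intro i hi
      rw [hwt, if_neg (by omega), children, if_neg (by omega), if_neg (by omega), leafWeight]
  have hu : treeH S δ u mid = S.add b b' := by
    rw [treeH_node, S.fsum_univ_eq_add (fun _ => fst) (fun _ => snd) hne,
      S.finProd_eq_one fun i => treeH_leaf hα fst, S.finProd_eq_one fun i => treeH_leaf hα snd]
    · simp [δ, S.one_mul, rankTransition, hs0, innerWeight, hne.symm]
    · intro qs h1 h2
      simp [δ, rankTransition, hs0, innerWeight, h1, h2, S.mul_zero]
  have ht : treeH S δ t top = S.mul (S.mul a (S.add b b')) c := by
    rw [treeH_node, S.fsum_univ_eq_single children,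
      S.finProd_eq_mul hs (a := a) (b := S.add b b')]
    · simp [δ, rankTransition, hs0, innerWeight]
    · intro i hi
      simp [hi, children, δ, treeH_leaf, leafWeight]
    · intro i hi
      simp [hi, children, hu]
    · intro i hi
      rw [if_neg (by omega), children, if_neg (by omega), if_neg (by omega), treeH_leaf,
        leafWeight]
    · intro qs hqs
      simp [δ, rankTransition, hs0, innerWeight, hqs, S.mul_zero]
  have hinit : treeInitSem S δ (finalWeight S) t = S.mul (S.mul a (S.add b b')) c := by
    rw [treeInitSem, S.fsum_univ_eq_single top, ht, finalWeight, S.mul_one]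
    intro q hq
    cases q <;> first | exact absurd rfl hq | exact S.mul_zero _
  have : Nonempty BranchState := ⟨top⟩
  exact hinit ▸ h BranchState δ (finalWeight S) hrun

end SeparatingAutomata

theorem stmt14 {B : Type} (S : StrongBimonoid B)
    (σt : Type) [Fintype σt] [Nonempty σt] (rk : σt → ℕ) (h0 : ∃ s, rk s = 0)
    (hzsf : S.ZeroSumFree) :
    ((¬ RankTrivial rk →
        ∀ b b' c : B, S.mul b c ≠ S.zero → S.mul (S.add b b') c ≠ S.zero) ∧
      (RankBranching rk →
        ∀ a b b' c : B,
          S.mul (S.mul a b) c ≠ S.zero → S.mul (S.mul a (S.add b b')) c ≠ S.zero)) ↔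
      (∀ (Q : Type) [Fintype Q] [Nonempty Q] (δ : (s : σt) → (Fin (rk s) → Q) → Q → B) (F : Q → B),
        {t : RTree σt rk | treeRunSem S δ F t ≠ S.zero} ⊆
          {t : RTree σt rk | treeInitSem S δ F t ≠ S.zero}) := by
  constructor
  · rintro ⟨h1, h2⟩ Q _ _ δ F t ht
    obtain ⟨ρ, hρ⟩ := S.exists_ne_zero_of_fsum_ne_zero ht
    refine hzsf.fsum_univ_ne_zero ρ.root ?_
    by_cases hb : RankBranching rk
    · have := mul_treeH_ne_zero_of_branching (δ := δ) (h2 hb) ρ S.one (F ρ.root)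
      simp only [S.one_mul] at this
      exact this hρ
    · exact treeH_mul_ne_zero_of_not_branching hb h1 ρ _ hρ
  · exact fun h => ⟨add_mul_ne_zero_of_supp_subset S h0 hzsf h,
      mul_add_mul_ne_zero_of_supp_subset S h0 hzsf h⟩
end
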